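/- Every submodular–concave game (with f continuous in y) admits a saddle point (x^⋆, y^⋆) ∈ [0,1]^n × Y with f_L(x^⋆, y) ≤ V^{⋆} ≤ f_L(x, y^⋆) for all x ∈ [0,1]^n and y ∈ Y, where V^{⋆} = min_x max_y f_L(x,y); moreover x^⋆ decomposes as a distribution over a chain of at most n+1 nested subsets, and V^{⋆} equals the mixed value V^{mix} = min_{μ ∈ Δ(2^{[n]})} max_{y ∈ Y} E_{S∼μ}[f(S,y)]. -/

import Mathlib

open scoped BigOperators

noncomputable section

/-- Submodularity of a set function on the ground set `Fin n`. -/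
def Submodular {n : ℕ} (f : Finset (Fin n) → ℝ) : Prop :=
  ∀ S T : Finset (Fin n), f (S ∪ T) + f (S ∩ T) ≤ f S + f T

/-- The chain set `C_i = {σ(0), …, σ(i-1)}` determined by a permutation `σ`. -/
def chainOf {n : ℕ} (σ : Equiv.Perm (Fin n)) (i : ℕ) : Finset (Fin n) :=
  (Finset.univ.filter fun k : Fin n => (k : ℕ) < i).image σ

/-- The permutation sorting `x` in descending order (deterministic tie-breaking). -/
def sortPerm {n : ℕ} (x : Fin n → ℝ) : Equiv.Perm (Fin n) :=
  Tuple.sort (fun i => -x i)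

/-- Sorted values `x_{π(i)}`, with the conventions `x_{π(0)} = 1` and `x_{π(n+1)} = 0`. -/
def sortedVal {n : ℕ} (x : Fin n → ℝ) (i : ℕ) : ℝ :=
  if _h0 : i = 0 then 1
  else if h : i ≤ n then x (sortPerm x ⟨i - 1, by omega⟩) else 0

/-- The Lovász extension `f_L(x) = ∑_{i=0}^n (x_{π(i)} − x_{π(i+1)}) f(C_i)`. -/
def lovasz {n : ℕ} (f : Finset (Fin n) → ℝ) (x : Fin n → ℝ) : ℝ :=
  ∑ i ∈ Finset.range (n + 1),
    (sortedVal x i - sortedVal x (i + 1)) * f (chainOf (sortPerm x) i)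

/-- Two-argument Lovász extension of a payoff `f : 2^{[n]} × Y → ℝ`. -/
def lovaszG {n m : ℕ} (f : Finset (Fin n) → (Fin m → ℝ) → ℝ)
    (x : Fin n → ℝ) (y : Fin m → ℝ) : ℝ :=
  lovasz (fun S => f S y) x

/-- The unit cube `[0,1]^n`. -/
def cube (n : ℕ) : Set (Fin n → ℝ) := Set.Icc (0 : Fin n → ℝ) 1

theorem sum_range_sub_mul_eq_sum_mul_sub (v F : ℕ → ℝ) (n : ℕ) :
    ∑ i ∈ Finset.range (n + 1), (v i - v (i + 1)) * F i =
      v 0 * F 0 + ∑ i ∈ Finset.range n, v (i + 1) * (F (i + 1) - F i) - v (n + 1) * F n := by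
  induction n with
  | zero => simp; ring
  | succ k ih => rw [Finset.sum_range_succ, ih, Finset.sum_range_succ]; ring

section Chain

variable {n : ℕ} (σ : Equiv.Perm (Fin n))

theorem mem_chainOf {i : ℕ} {e : Fin n} : e ∈ chainOf σ i ↔ (σ.symm e : ℕ) < i := by
  simp only [chainOf, Finset.mem_image, Finset.mem_filter, Finset.mem_univ, true_and]
  constructor
  · rintro ⟨k, hk, rfl⟩
    simpa using hk
  · intro h
    exact ⟨σ.symm e, h, by simp⟩

theorem chainOf_zero : chainOf σ 0 = ∅ := by
  ext e; simp [mem_chainOf]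

theorem chainOf_eq_univ : chainOf σ n = Finset.univ := by
  ext e; simp [mem_chainOf]

theorem apply_notMem_chainOf (i : Fin n) : σ i ∉ chainOf σ i := by
  simp [mem_chainOf]

theorem chainOf_succ (i : Fin n) : chainOf σ (i + 1) = insert (σ i) (chainOf σ i) := by
  ext e
  rw [Finset.mem_insert, mem_chainOf, mem_chainOf, ← Equiv.symm_apply_eq, Fin.ext_iff]
  omega

theorem chainOf_ssubset_succ (i : Fin n) : chainOf σ i ⊂ chainOf σ (i + 1) := by
  rw [chainOf_succ]
  exact Finset.ssubset_insert (apply_notMem_chainOf σ i)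

/-- The greedy marginal vector along a chain lies in the base polytope of a submodular function. -/
theorem Submodular.add_sum_marginal_le {f : Finset (Fin n) → ℝ} (hf : Submodular f)
    (S : Finset (Fin n)) :
    f ∅ + ∑ i : Fin n, (if σ i ∈ S then 1 else 0) *
      (f (chainOf σ (i + 1)) - f (chainOf σ i)) ≤ f S := by
  have step (i : Fin n) : (if σ i ∈ S then 1 else 0) *
      (f (chainOf σ (i + 1)) - f (chainOf σ i)) ≤
        f (S ∩ chainOf σ (i + 1)) - f (S ∩ chainOf σ i) := by
    rw [chainOf_succ]
    split_ifs with h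
    · have hunion : S ∩ insert (σ i) (chainOf σ i) ∪ chainOf σ i =
          insert (σ i) (chainOf σ i) := by
        ext e; simp only [Finset.mem_union, Finset.mem_inter, Finset.mem_insert]; grind
      have hinter : S ∩ insert (σ i) (chainOf σ i) ∩ chainOf σ i = S ∩ chainOf σ i := by
        ext e; simp only [Finset.mem_inter, Finset.mem_insert]; grind
      have := hf (S ∩ insert (σ i) (chainOf σ i)) (chainOf σ i)
      rw [hunion, hinter] at this
      linarith
    · rw [Finset.inter_insert_of_notMem h]
      simp
  have htele : ∑ i : Fin n, (f (S ∩ chainOf σ (i + 1)) - f (S ∩ chainOf σ i)) =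
      f S - f ∅ := by
    rw [Fin.sum_univ_eq_sum_range (fun i => f (S ∩ chainOf σ (i + 1)) - f (S ∩ chainOf σ i)) n,
      Finset.sum_range_sub (fun i => f (S ∩ chainOf σ i)), chainOf_eq_univ, chainOf_zero]
    simp
  have := Finset.sum_le_sum fun i (_ : i ∈ Finset.univ) => step i
  linarith

end Chain

section Lovasz

variable {n : ℕ}

/-- The weight of the `i`-th chain set in the Lovász extension at `x`. -/
def chainWeight (x : Fin n → ℝ) (i : ℕ) : ℝ :=
  sortedVal x i - sortedVal x (i + 1)

theorem sortedVal_zero (x : Fin n → ℝ) : sortedVal x 0 = 1 := by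
  simp [sortedVal]

theorem sortedVal_succ (x : Fin n → ℝ) (i : Fin n) :
    sortedVal x (i + 1) = x (sortPerm x i) := by
  have : (i : ℕ) + 1 ≤ n := i.isLt
  simp [sortedVal, this]

theorem sortedVal_last (x : Fin n → ℝ) : sortedVal x (n + 1) = 0 := by
  simp [sortedVal]

theorem antitone_comp_sortPerm (x : Fin n → ℝ) : Antitone (x ∘ sortPerm x) := by
  intro i j hij
  have := Tuple.monotone_sort (fun i => -x i) hij
  simpa [sortPerm] using this

theorem chainWeight_nonneg {x : Fin n → ℝ} (hx : x ∈ cube n) {i : ℕ} (hi : i ≤ n) :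
    0 ≤ chainWeight x i := by
  rw [chainWeight, sub_nonneg]
  rcases hi.eq_or_lt with rfl | hi
  · rw [sortedVal_last]
    cases i with
    | zero => rw [sortedVal_zero]; exact zero_le_one
    | succ k => rw [sortedVal_succ x ⟨k, k.lt_succ_self⟩]; exact hx.1 _
  · rw [sortedVal_succ x ⟨i, hi⟩]
    cases i with
    | zero => rw [sortedVal_zero]; exact hx.2 _
    | succ k =>
      rw [sortedVal_succ x ⟨k, by omega⟩]
      exact antitone_comp_sortPerm x (Fin.mk_le_mk.2 k.le_succ)

theorem sum_chainWeight (x : Fin n → ℝ) : ∑ i ∈ Finset.range (n + 1), chainWeight x i = 1 := by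
  simp only [chainWeight]
  rw [Finset.sum_range_sub', sortedVal_zero, sortedVal_last, sub_zero]

theorem lovasz_eq_sum_chainWeight (f : Finset (Fin n) → ℝ) (x : Fin n → ℝ) :
    lovasz f x = ∑ i ∈ Finset.range (n + 1), chainWeight x i * f (chainOf (sortPerm x) i) :=
  rfl

theorem lovasz_eq_add_sum_marginal (f : Finset (Fin n) → ℝ) (x : Fin n → ℝ) :
    lovasz f x = f ∅ + ∑ i : Fin n, x (sortPerm x i) *
      (f (chainOf (sortPerm x) (i + 1)) - f (chainOf (sortPerm x) i)) := by
  rw [lovasz, sum_range_sub_mul_eq_sum_mul_sub (sortedVal x) (fun i => f (chainOf (sortPerm x) i)),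
    sortedVal_zero, sortedVal_last, chainOf_zero, Finset.sum_range]
  simp only [sortedVal_succ]
  ring

theorem le_lovasz_of_forall_le {f : Finset (Fin n) → ℝ} {v : ℝ} (hv : ∀ S, v ≤ f S)
    {x : Fin n → ℝ} (hx : x ∈ cube n) : v ≤ lovasz f x := by
  calc v = ∑ i ∈ Finset.range (n + 1), chainWeight x i * v := by
        rw [← Finset.sum_mul, sum_chainWeight, one_mul]
    _ ≤ lovasz f x := Finset.sum_le_sum fun i hi => mul_le_mul_of_nonneg_left (hv _)
        (chainWeight_nonneg hx (Nat.lt_succ_iff.1 (Finset.mem_range.1 hi)))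

/-- The probability that each element belongs to a random set distributed according to `μ`. -/
def marginalProb (μ : Finset (Fin n) → ℝ) (e : Fin n) : ℝ :=
  ∑ S, μ S * if e ∈ S then 1 else 0

theorem marginalProb_mem_cube {μ : Finset (Fin n) → ℝ} (hμ : μ ∈ stdSimplex ℝ (Finset (Fin n))) :
    marginalProb μ ∈ cube n := by
  refine ⟨fun e => Finset.sum_nonneg fun S _ => mul_nonneg (hμ.1 S) (by split_ifs <;> simp),
    fun e => ?_⟩
  calc marginalProb μ e ≤ ∑ S, μ S := Finset.sum_le_sum fun S _ =>
        mul_le_of_le_one_right (hμ.1 S) (by split_ifs <;> simp)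
    _ = 1 := hμ.2

/-- Uncrossing: among all distributions with given marginals, the chain distribution minimizes
the expectation of a submodular function. -/
theorem Submodular.lovasz_marginalProb_le {f : Finset (Fin n) → ℝ} (hf : Submodular f)
    {μ : Finset (Fin n) → ℝ} (hμ : μ ∈ stdSimplex ℝ (Finset (Fin n))) :
    lovasz f (marginalProb μ) ≤ ∑ S, μ S * f S := by
  set σ := sortPerm (marginalProb μ) with hσ
  calc lovasz f (marginalProb μ)
      = ∑ S, μ S * (f ∅ + ∑ i : Fin n, (if σ i ∈ S then 1 else 0) *
          (f (chainOf σ (i + 1)) - f (chainOf σ i))) := by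
        rw [lovasz_eq_add_sum_marginal, ← hσ]
        simp only [mul_add, Finset.sum_add_distrib, ← Finset.sum_mul, hμ.2, one_mul,
          marginalProb, Finset.mul_sum]
        rw [Finset.sum_comm]
        simp only [Finset.sum_mul, mul_assoc]
    _ ≤ ∑ S, μ S * f S := Finset.sum_le_sum fun S _ =>
        mul_le_mul_of_nonneg_left (hf.add_sum_marginal_le σ S) (hμ.1 S)

end Lovasz

theorem sInf_sSup_eq_of_saddle {α β : Type*} {X : Set α} {Y : Set β} {g : α → β → ℝ} {a : α}
    {b : β} {v : ℝ} (ha : a ∈ X) (hb : b ∈ Y) (hmax : ∀ y ∈ Y, g a y ≤ v)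
    (hmin : ∀ x ∈ X, v ≤ g x b) (hbdd : ∀ x ∈ X, BddAbove (g x '' Y)) :
    sInf ((fun x => sSup ((fun y => g x y) '' Y)) '' X) = v := by
  have hle (x) (hx : x ∈ X) : v ≤ sSup (g x '' Y) :=
    (hmin x hx).trans (le_csSup (hbdd x hx) ⟨b, hb, rfl⟩)
  refine IsLeast.csInf_eq ⟨⟨a, ha, le_antisymm ?_ (hle a ha)⟩, ?_⟩
  · exact csSup_le (Set.Nonempty.image _ ⟨b, hb⟩) (Set.forall_mem_image.2 hmax)
  · exact Set.forall_mem_image.2 hle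

/-- Sion's theorem for the mixed extension of a finite-versus-concave game. -/
theorem exists_mixed_saddle {ι E : Type*} [Fintype ι] [DecidableEq ι] [Nonempty ι]
    [TopologicalSpace E] [AddCommGroup E] [Module ℝ E] [IsTopologicalAddGroup E]
    [ContinuousSMul ℝ E] {Y : Set E} (hYcomp : IsCompact Y) (hYconv : Convex ℝ Y)
    (hYne : Y.Nonempty) {f : ι → E → ℝ} (hconc : ∀ i, ConcaveOn ℝ Y (f i))
    (hcont : ∀ i, ContinuousOn (f i) Y) :
    ∃ μ ∈ stdSimplex ℝ ι, ∃ b ∈ Y, ∃ v : ℝ,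
      (∀ y ∈ Y, ∑ i, μ i * f i y ≤ v) ∧ ∀ i, v ≤ f i b := by
  obtain ⟨μ, hμ, b, hb, hsaddle⟩ := Sion.exists_isSaddlePointOn (X := stdSimplex ℝ ι) (Y := Y)
    (f := fun μ y => ∑ i, μ i * f i y)
    ⟨_, single_mem_stdSimplex ℝ (Classical.arbitrary ι)⟩ (convex_stdSimplex ℝ ι)
    (isCompact_stdSimplex ℝ ι)
    (fun y _ => Continuous.lowerSemicontinuous (by fun_prop) |>.lowerSemicontinuousOn _)
    (fun y _ => ConvexOn.quasiconvexOn
      ⟨convex_stdSimplex ℝ ι, fun p _ q _ s t _ _ _ => le_of_eq <| by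
        simp only [Pi.add_apply, Pi.smul_apply, smul_eq_mul, Finset.mul_sum,
          ← Finset.sum_add_distrib]
        exact Finset.sum_congr rfl fun i _ => by ring⟩)
    hYconv hYne hYcomp
    (fun p _ => ContinuousOn.upperSemicontinuousOn (by fun_prop))
    (fun p hp => ConcaveOn.quasiconcaveOn
      ⟨hYconv, fun y hy z hz s t hs ht hst => by
        simp only [smul_eq_mul, Finset.mul_sum, ← Finset.sum_add_distrib]
        refine Finset.sum_le_sum fun i _ => ?_
        have := mul_le_mul_of_nonneg_left ((hconc i).2 hy hz hs ht hst) (hp.1 i)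
        simp only [smul_eq_mul] at this
        linarith⟩)
  refine ⟨μ, hμ, b, hb, ∑ i, μ i * f i b, fun y hy => hsaddle μ hμ y hy, fun i => ?_⟩
  simpa [Pi.single_apply] using hsaddle _ (single_mem_stdSimplex ℝ i) b hb

/-- Mixed equilibrium existence.
Every submodular–concave game (with `f` continuous in `y`) admits a saddle point
`(x⋆, y⋆) ∈ [0,1]^n × Y` with `f_L(x⋆, y) ≤ V⋆ ≤ f_L(x, y⋆)` for all `x, y`, where
`V⋆ = min_x max_y f_L(x,y)`; moreover `x⋆` decomposes over a chain of at most `n+1`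
nested subsets, and `V⋆` equals the mixed value `V^mix`. -/
theorem mixed_equilibrium_existence {n m : ℕ} (hn : 1 ≤ n)
    (Y : Set (Fin m → ℝ)) (hYcomp : IsCompact Y) (hYconv : Convex ℝ Y)
    (hYne : Y.Nonempty)
    (f : Finset (Fin n) → (Fin m → ℝ) → ℝ)
    (hsub : ∀ y ∈ Y, Submodular (fun S => f S y))
    (hconc : ∀ S : Finset (Fin n), ConcaveOn ℝ Y (f S))
    (hcont : ∀ S : Finset (Fin n), ContinuousOn (f S) Y)
    (Vstar : ℝ)
    (hV : Vstar = sInf ((fun x => sSup ((fun y => lovaszG f x y) '' Y)) '' cube n)) :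
    ∃ xstar ∈ cube n, ∃ ystar ∈ Y,
      (∀ y ∈ Y, lovaszG f xstar y ≤ Vstar) ∧
      (∀ x ∈ cube n, Vstar ≤ lovaszG f x ystar) ∧
      (∃ (K : ℕ) (_hK : K ≤ n) (C : Fin (K + 1) → Finset (Fin n)) (w : Fin (K + 1) → ℝ),
        C 0 = ∅ ∧ C (Fin.last K) = Finset.univ ∧
        (∀ j : Fin K, C j.castSucc ⊂ C j.succ) ∧
        (∀ j, 0 ≤ w j) ∧ (∑ j, w j = 1) ∧
        (∀ y ∈ Y, lovaszG f xstar y = ∑ j, w j * f (C j) y)) ∧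
      Vstar = sInf ((fun μ => sSup ((fun y => ∑ S : Finset (Fin n), μ S * f S y) '' Y)) ''
          stdSimplex ℝ (Finset (Fin n))) := by
  obtain ⟨μ, hμ, b, hb, v, hmax, hmin⟩ := exists_mixed_saddle hYcomp hYconv hYne hconc hcont
  have hxs := marginalProb_mem_cube hμ
  have hle : ∀ y ∈ Y, lovaszG f (marginalProb μ) y ≤ v := fun y hy =>
    ((hsub y hy).lovasz_marginalProb_le hμ).trans (hmax y hy)
  have hge : ∀ x ∈ cube n, v ≤ lovaszG f x b := fun x hx => le_lovasz_of_forall_le hmin hx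
  have hgemix : ∀ p ∈ stdSimplex ℝ (Finset (Fin n)), v ≤ ∑ S, p S * f S b := fun p hp => by
    calc v = ∑ S, p S * v := by rw [← Finset.sum_mul, hp.2, one_mul]
      _ ≤ _ := Finset.sum_le_sum fun S _ => mul_le_mul_of_nonneg_left (hmin S) (hp.1 S)
  have hVv : Vstar = v := by
    rw [hV]
    refine sInf_sSup_eq_of_saddle hxs hb hle hge fun x _ => hYcomp.bddAbove_image ?_
    unfold lovaszG lovasz
    fun_prop
  subst hVv
  refine ⟨marginalProb μ, hxs, b, hb, hle, hge, ?_, ?_⟩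
  · refine ⟨n, le_rfl, fun j => chainOf (sortPerm (marginalProb μ)) j,
      fun j => chainWeight (marginalProb μ) j, chainOf_zero _, chainOf_eq_univ _,
      fun j => chainOf_ssubset_succ _ j,
      fun j => chainWeight_nonneg hxs (Nat.lt_succ_iff.1 j.isLt), ?_, fun y _ => ?_⟩
    · rw [← sum_chainWeight (marginalProb μ), Finset.sum_range]
    · rw [lovaszG, lovasz_eq_sum_chainWeight, Finset.sum_range]
  · exact (sInf_sSup_eq_of_saddle hμ hb hmax hgemix fun p _ =>
      hYcomp.bddAbove_image (by fun_prop)).symm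

end
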